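/- There exist unique ℂ-algebra homomorphisms Δ : D → D ⊗ D and ε : D → ℂ with Δ(e) = 1⊗e + e⊗k², Δ(φ) = k⁻²⊗φ + φ⊗1, Δ(k^{±1}) = k^{±1}⊗k^{±1}, ε(e) = ε(φ) = 0, ε(k^{±1}) = 1, and a unique ℂ-algebra anti-homomorphism S : D → D with S(e) = −e k⁻², S(φ) = −k² φ, S(k^{±1}) = k^{∓1}, and these maps make D a Hopf algebra over ℂ (Δ is coassociative, ε is a counit, and S is an antipode). -/

import Mathlib

open scoped TensorProduct
open Finset

noncomputable section

namespace LogHennings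

/-- `q = exp(iπ/p)`. -/
def qq (p : ℕ) : ℂ := Complex.exp ((Real.pi : ℂ) * Complex.I / (p : ℂ))

/-- `q^{1/2} = exp(iπ/(2p))`. -/
def qh (p : ℕ) : ℂ := Complex.exp ((Real.pi : ℂ) * Complex.I / (2 * (p : ℂ)))

/-- quantum integer `[m] = (q^m - q^{-m})/(q - q⁻¹)`. -/
def qnum (p m : ℕ) : ℂ := ((qq p) ^ m - (qq p)⁻¹ ^ m) / (qq p - (qq p)⁻¹)

/-- quantum factorial `[m]! = [m][m-1]⋯[1]`. -/
def qfac (p : ℕ) : ℕ → ℂ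
  | 0 => 1
  | m + 1 => qnum p (m + 1) * qfac p m

/-- Generators of the restricted quantum group `U`. -/
inductive UGen | E | F | K | Kinv

abbrev FU := FreeAlgebra ℂ UGen

def fE : FU := FreeAlgebra.ι ℂ UGen.E
def fF : FU := FreeAlgebra.ι ℂ UGen.F
def fK : FU := FreeAlgebra.ι ℂ UGen.K
def fKinv : FU := FreeAlgebra.ι ℂ UGen.Kinv

/-- Defining relations of the restricted quantum group `U`. -/
inductive URel (p : ℕ) : FU → FU → Prop
  | Epow : URel p (fE ^ p) 0
  | Fpow : URel p (fF ^ p) 0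
  | Kpow : URel p (fK ^ (2 * p)) 1
  | KKinv : URel p (fK * fKinv) 1
  | KinvK : URel p (fKinv * fK) 1
  | KE : URel p (fK * fE * fKinv) ((qq p) ^ 2 • fE)
  | KF : URel p (fK * fF * fKinv) (((qq p) ^ 2)⁻¹ • fF)
  | EF : URel p (fE * fF - fF * fE) ((qq p - (qq p)⁻¹)⁻¹ • (fK - fKinv))

/-- The restricted quantum group `U = \bar U_q(sl2)`. -/
abbrev Uq (p : ℕ) := RingQuot (URel p)

def UE (p : ℕ) : Uq p := RingQuot.mkAlgHom ℂ (URel p) fE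
def UF (p : ℕ) : Uq p := RingQuot.mkAlgHom ℂ (URel p) fF
def UK (p : ℕ) : Uq p := RingQuot.mkAlgHom ℂ (URel p) fK
def UKinv (p : ℕ) : Uq p := RingQuot.mkAlgHom ℂ (URel p) fKinv

/-- Generators of the braided extension `D`. -/
inductive DGen | e | phi | k | kinv

abbrev FD := FreeAlgebra ℂ DGen

def fe : FD := FreeAlgebra.ι ℂ DGen.e
def fphi : FD := FreeAlgebra.ι ℂ DGen.phi
def fk : FD := FreeAlgebra.ι ℂ DGen.k
def fkinv : FD := FreeAlgebra.ι ℂ DGen.kinv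

/-- Defining relations of `D`. -/
inductive DRel (p : ℕ) : FD → FD → Prop
  | epow : DRel p (fe ^ p) 0
  | phipow : DRel p (fphi ^ p) 0
  | kpow : DRel p (fk ^ (4 * p)) 1
  | kkinv : DRel p (fk * fkinv) 1
  | kinvk : DRel p (fkinv * fk) 1
  | ke : DRel p (fk * fe * fkinv) (qq p • fe)
  | kphi : DRel p (fk * fphi * fkinv) ((qq p)⁻¹ • fphi)
  | ephi : DRel p (fe * fphi - fphi * fe)
      ((qq p - (qq p)⁻¹)⁻¹ • (fk ^ 2 - fkinv ^ 2))

/-- The braided extension `D` of `U`. -/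
abbrev Dq (p : ℕ) := RingQuot (DRel p)

def De (p : ℕ) : Dq p := RingQuot.mkAlgHom ℂ (DRel p) fe
def Dphi (p : ℕ) : Dq p := RingQuot.mkAlgHom ℂ (DRel p) fphi
def Dk (p : ℕ) : Dq p := RingQuot.mkAlgHom ℂ (DRel p) fk
def Dkinv (p : ℕ) : Dq p := RingQuot.mkAlgHom ℂ (DRel p) fkinv

/-- The `R`-matrix of `D`. -/
def Rmat (p : ℕ) : Dq p ⊗[ℂ] Dq p :=
  ((4 * (p : ℂ))⁻¹) •
    ∑ m ∈ range p, ∑ n ∈ range (4 * p), ∑ j ∈ range (4 * p),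
      (((qq p - (qq p)⁻¹) ^ m / qfac p m) *
          (qh p) ^ ((m : ℤ) * ((m : ℤ) - 1) + 2 * (m : ℤ) * ((n : ℤ) - (j : ℤ))
            - (n : ℤ) * (j : ℤ))) •
        ((De p ^ m * Dk p ^ n) ⊗ₜ[ℂ] (Dphi p ^ m * Dk p ^ j))

/-- `R₂₁ = τ(R)`. -/
def R21 (p : ℕ) : Dq p ⊗[ℂ] Dq p := TensorProduct.comm ℂ (Dq p) (Dq p) (Rmat p)

/-- The monodromy `M = R₂₁ R`. -/
def Mmat (p : ℕ) : Dq p ⊗[ℂ] Dq p := R21 p * Rmat p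

/-- The ribbon element `r ∈ D`. -/
def rib (p : ℕ) : Dq p :=
  ((1 - Complex.I) / (2 * (Real.sqrt p : ℂ))) •
    ∑ m ∈ range p, ∑ j ∈ range (2 * p),
      (((qq p - (qq p)⁻¹) ^ m / qfac p m) *
          (qh p) ^ (-(m : ℤ) + 2 * (m : ℤ) * (j : ℤ) + ((j : ℤ) + (p : ℤ) + 1) ^ 2)) •
        (Dphi p ^ m * De p ^ m * Dk p ^ (2 * j))

/-- The Drinfeld element `u = Σ S(β_i) α_i` for `R = Σ α_i ⊗ β_i`,
depending on a choice of antipode `S`. -/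
def drinfeldU (p : ℕ) (S : Dq p →ₗ[ℂ] Dq p) : Dq p :=
  LinearMap.mul' ℂ (Dq p) (TensorProduct.map S LinearMap.id (R21 p))

/-- `Δ` takes the prescribed values on the generators of `U`. -/
def IsDeltaU (p : ℕ) (Δ : Uq p →ₐ[ℂ] Uq p ⊗[ℂ] Uq p) : Prop :=
  Δ (UE p) = 1 ⊗ₜ[ℂ] UE p + UE p ⊗ₜ[ℂ] UK p ∧
  Δ (UF p) = UKinv p ⊗ₜ[ℂ] UF p + UF p ⊗ₜ[ℂ] 1 ∧
  Δ (UK p) = UK p ⊗ₜ[ℂ] UK p ∧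
  Δ (UKinv p) = UKinv p ⊗ₜ[ℂ] UKinv p

/-- `ε` takes the prescribed values on the generators of `U`. -/
def IsCounitU (p : ℕ) (ε : Uq p →ₐ[ℂ] ℂ) : Prop :=
  ε (UE p) = 0 ∧ ε (UF p) = 0 ∧ ε (UK p) = 1 ∧ ε (UKinv p) = 1

/-- `S` is an algebra anti-homomorphism taking the prescribed values on the
generators of `U`. -/
def IsAntipodeU (p : ℕ) (S : Uq p →ₗ[ℂ] Uq p) : Prop :=
  S 1 = 1 ∧ (∀ x y, S (x * y) = S y * S x) ∧
  S (UE p) = -(UE p * UKinv p) ∧ S (UF p) = -(UK p * UF p) ∧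
  S (UK p) = UKinv p ∧ S (UKinv p) = UK p

/-- `Δ` takes the prescribed values on the generators of `D`. -/
def IsDeltaD (p : ℕ) (Δ : Dq p →ₐ[ℂ] Dq p ⊗[ℂ] Dq p) : Prop :=
  Δ (De p) = 1 ⊗ₜ[ℂ] De p + De p ⊗ₜ[ℂ] (Dk p ^ 2) ∧
  Δ (Dphi p) = (Dkinv p ^ 2) ⊗ₜ[ℂ] Dphi p + Dphi p ⊗ₜ[ℂ] 1 ∧
  Δ (Dk p) = Dk p ⊗ₜ[ℂ] Dk p ∧
  Δ (Dkinv p) = Dkinv p ⊗ₜ[ℂ] Dkinv p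

/-- `ε` takes the prescribed values on the generators of `D`. -/
def IsCounitD (p : ℕ) (ε : Dq p →ₐ[ℂ] ℂ) : Prop :=
  ε (De p) = 0 ∧ ε (Dphi p) = 0 ∧ ε (Dk p) = 1 ∧ ε (Dkinv p) = 1

/-- `S` is an algebra anti-homomorphism taking the prescribed values on the
generators of `D`. -/
def IsAntipodeD (p : ℕ) (S : Dq p →ₗ[ℂ] Dq p) : Prop :=
  S 1 = 1 ∧ (∀ x y, S (x * y) = S y * S x) ∧
  S (De p) = -(De p * Dkinv p ^ 2) ∧ S (Dphi p) = -(Dk p ^ 2 * Dphi p) ∧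
  S (Dk p) = Dkinv p ∧ S (Dkinv p) = Dk p

/-- `ι` takes the prescribed values `E ↦ e`, `F ↦ φ`, `K^{±1} ↦ k^{±2}`. -/
def IsIota (p : ℕ) (ι : Uq p →ₐ[ℂ] Dq p) : Prop :=
  ι (UE p) = De p ∧ ι (UF p) = Dphi p ∧ ι (UK p) = Dk p ^ 2 ∧
  ι (UKinv p) = Dkinv p ^ 2

/-- `μ` takes the prescribed values on the PBW basis of `U`. -/
def IsMu (p : ℕ) (μ : Uq p →ₗ[ℂ] ℂ) : Prop :=
  ∀ m n l : ℕ, m < p → n < p → l < 2 * p →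
    μ (UE p ^ m * UF p ^ n * UK p ^ l) =
      if m = p - 1 ∧ n = p - 1 ∧ l = p + 1 then
        -((Real.sqrt (2 / (p : ℝ)) : ℂ)) * (qfac p (p - 1)) ^ 2
      else 0

variable {A : Type*} [Ring A] [Algebra ℂ A]

/-- Coassociativity of a comultiplication. -/
def Coassoc (Δ : A →ₐ[ℂ] A ⊗[ℂ] A) : Prop :=
  ∀ x, TensorProduct.assoc ℂ A A A
      (TensorProduct.map Δ.toLinearMap LinearMap.id (Δ x)) =
    TensorProduct.map LinearMap.id Δ.toLinearMap (Δ x)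

/-- The counit axiom. -/
def CounitAxiom (Δ : A →ₐ[ℂ] A ⊗[ℂ] A) (ε : A →ₐ[ℂ] ℂ) : Prop :=
  (∀ x, TensorProduct.lid ℂ A
      (TensorProduct.map ε.toLinearMap LinearMap.id (Δ x)) = x) ∧
  (∀ x, TensorProduct.rid ℂ A
      (TensorProduct.map LinearMap.id ε.toLinearMap (Δ x)) = x)

/-- The antipode axiom. -/
def AntipodeAxiom (Δ : A →ₐ[ℂ] A ⊗[ℂ] A) (ε : A →ₐ[ℂ] ℂ)
    (S : A →ₗ[ℂ] A) : Prop :=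
  (∀ x, LinearMap.mul' ℂ A (TensorProduct.map S LinearMap.id (Δ x)) = ε x • 1) ∧
  (∀ x, LinearMap.mul' ℂ A (TensorProduct.map LinearMap.id S (Δ x)) = ε x • 1)

/-- `x ↦ x ⊗ 1`. -/
def e1 (p : ℕ) : Dq p →ₗ[ℂ] Dq p ⊗[ℂ] Dq p :=
  (TensorProduct.mk ℂ (Dq p) (Dq p)).flip 1

/-- `x ↦ 1 ⊗ x`. -/
def e2 (p : ℕ) : Dq p →ₗ[ℂ] Dq p ⊗[ℂ] Dq p :=
  TensorProduct.mk ℂ (Dq p) (Dq p) 1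

/-- The balancing element `g = K^{p+1}`. -/
def gU (p : ℕ) : Uq p := UK p ^ (p + 1)

/-- The span of commutators `[U,U]`. -/
def commSpan (p : ℕ) : Submodule ℂ (Uq p) :=
  Submodule.span ℂ {z : Uq p | ∃ x y : Uq p, z = x * y - y * x}

end LogHennings

namespace LogHennings

/-- Gaussian binomial coefficients, by the Pascal recursion. -/
def gbin (w : ℂ) : ℕ → ℕ → ℂ
  | 0, 0 => 1
  | 0, _ + 1 => 0
  | n + 1, 0 => gbin w n 0
  | n + 1, k + 1 => gbin w n k + w ^ (k + 1) * gbin w n (k + 1)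

lemma gbin_zero_right (w : ℂ) (n : ℕ) : gbin w n 0 = 1 := by
  induction n with
  | zero => rfl
  | succ n ih => rw [gbin, ih]

lemma gbin_gt (w : ℂ) (n : ℕ) : ∀ k, n < k → gbin w n k = 0 := by
  induction n with
  | zero => intro k hk; cases k with
    | zero => omega
    | succ k => rfl
  | succ n ih => intro k hk; cases k with
    | zero => omega
    | succ k => rw [gbin, ih k (by omega), ih (k + 1) (by omega)]; ring

lemma gbin_self (w : ℂ) (n : ℕ) : gbin w n n = 1 := by
  induction n with
  | zero => rfl
  | succ n ih => rw [gbin, ih, gbin_gt w n (n + 1) (by omega)]; ring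

lemma gbin_identities (w : ℂ) (n : ℕ) : ∀ k,
    (1 - w ^ (k + 1)) * gbin w (n + 1) (k + 1) = (1 - w ^ (n + 1)) * gbin w n k ∧
    (w ^ k - w ^ (n + 1)) * gbin w (n + 1) k = w ^ k * (1 - w ^ (n + 1)) * gbin w n k := by
  induction n with
  | zero =>
    intro k
    rcases k with _ | _ | k
    · simp [gbin]
    · simp [gbin]
    · simp [gbin]
  | succ n ih =>
    intro k
    constructor
    · obtain ⟨hA, hB⟩ := ih k
      rw [gbin]
      linear_combination w ^ (k + 1) * hA - w * hB
    · cases k with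
      | zero => simp [gbin_zero_right]
      | succ j =>
        obtain ⟨hA, hB⟩ := ih j
        rw [gbin]
        linear_combination w * hB - w ^ (j + 1) * hA

lemma gbin_prim {w : ℂ} {p : ℕ} (hw : IsPrimitiveRoot w p) (k : ℕ) (h0 : 0 < k) (hk : k < p) :
    gbin w p k = 0 := by
  obtain ⟨n, rfl⟩ : ∃ n, p = n + 1 := ⟨p - 1, by omega⟩
  obtain ⟨j, rfl⟩ : ∃ n, k = n + 1 := ⟨k - 1, by omega⟩
  have h := (gbin_identities w n j).1
  rw [hw.pow_eq_one, sub_self, zero_mul] at h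
  have h1 := hw.pow_ne_one_of_pos_of_lt (by omega : j + 1 ≠ 0) hk
  exact (mul_eq_zero.1 h).resolve_left (fun h2 => h1 (by linear_combination -h2))

section Alg
variable {A : Type*} [Ring A] [Algebra ℂ A]

lemma qcomm_pow {w : ℂ} {X Y : A} (h : Y * X = w • (X * Y)) (n : ℕ) :
    Y * X ^ n = w ^ n • (X ^ n * Y) := by
  induction n with
  | zero => simp
  | succ n ih =>
    rw [pow_succ, ← mul_assoc, ih, smul_mul_assoc, mul_assoc, h, mul_smul_comm, smul_smul,
      mul_assoc, pow_succ]

lemma qbinom {w : ℂ} {X Y : A} (h : Y * X = w • (X * Y)) (n : ℕ) :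
    (X + Y) ^ n = ∑ k ∈ range (n + 1), gbin w n k • (X ^ k * Y ^ (n - k)) := by
  induction n with
  | zero => simp [gbin]
  | succ n ih =>
    rw [pow_succ', ih, add_mul, Finset.mul_sum, Finset.mul_sum]
    rw [Finset.sum_range_succ' _ (n + 1)]
    simp only [gbin, add_smul, Finset.sum_add_distrib]
    rw [add_assoc]
    congr 1
    · refine Finset.sum_congr rfl fun k hk => ?_
      rw [mul_smul_comm, ← mul_assoc, ← pow_succ', Nat.add_sub_add_right]
    · have h1 : ∀ k ∈ range (n + 1), Y * gbin w n k • (X ^ k * Y ^ (n - k)) =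
          (w ^ k * gbin w n k) • (X ^ k * Y ^ (n + 1 - k)) := by
        intro k hk
        rw [mul_smul_comm, ← mul_assoc, qcomm_pow h, smul_mul_assoc, smul_smul, mul_assoc,
          ← pow_succ', mul_comm (w ^ k), Nat.sub_add_comm (by simp at hk; omega)]
      rw [Finset.sum_congr rfl h1, Finset.sum_range_succ']
      congr 1
      · rw [Finset.sum_range_succ _ n, gbin_gt w n (n + 1) (by omega)]
        simp
      · simp

lemma qbinom_prim {w : ℂ} {X Y : A} {p : ℕ} (hp : 0 < p) (hw : IsPrimitiveRoot w p)
    (h : Y * X = w • (X * Y)) (hX : X ^ p = 0) (hY : Y ^ p = 0) : (X + Y) ^ p = 0 := by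
  rw [qbinom h]
  refine Finset.sum_eq_zero fun k hk => ?_
  rcases Nat.eq_zero_or_pos k with rfl | h0
  · simp [hY]
  · rcases Nat.lt_or_ge k p with h1 | h1
    · rw [gbin_prim hw k h0 h1, zero_smul]
    · obtain rfl : k = p := by simp at hk; omega
      simp [hX]

/-- a `q`-commuting pair: the `n`-th power of the product is a multiple of the product of powers -/
lemma qcomm_mul_pow_zero {w : ℂ} {X Y : A} (h : Y * X = w • (X * Y)) (p : ℕ) (hX : X ^ p = 0) :
    (X * Y) ^ p = 0 := by
  have : ∀ n, ∃ c : ℂ, (X * Y) ^ n = c • (X ^ n * Y ^ n) := by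
    intro n
    induction n with
    | zero => exact ⟨1, by simp⟩
    | succ n ih =>
      obtain ⟨c, hc⟩ := ih
      refine ⟨c * w ^ n, ?_⟩
      rw [pow_succ', hc, mul_smul_comm, mul_assoc, ← mul_assoc Y, qcomm_pow h, smul_mul_assoc,
        mul_smul_comm, smul_smul, mul_assoc, ← pow_succ', ← mul_assoc, ← pow_succ']
  obtain ⟨c, hc⟩ := this p
  rw [hc, hX, zero_mul, smul_zero]

end Alg

lemma qq_ne_zero (p : ℕ) : qq p ≠ 0 := Complex.exp_ne_zero _

lemma qq_sq_prim (p : ℕ) (hp : 2 ≤ p) : IsPrimitiveRoot (qq p ^ 2) p := by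
  have := Complex.isPrimitiveRoot_exp p (by omega)
  convert this using 1
  rw [qq, ← Complex.exp_nat_mul]
  congr 1
  push_cast
  ring

/-- the relations of `D` in an algebra -/
structure DSys (p : ℕ) {B : Type*} [Ring B] [Algebra ℂ B] (E F K L : B) : Prop where
  epow : E ^ p = 0
  phipow : F ^ p = 0
  kpow : K ^ (4 * p) = 1
  kkinv : K * L = 1
  kinvk : L * K = 1
  ke : K * E * L = qq p • E
  kphi : K * F * L = (qq p)⁻¹ • F
  ephi : E * F - F * E = (qq p - (qq p)⁻¹)⁻¹ • (K ^ 2 - L ^ 2)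

lemma dsys_D (p : ℕ) : DSys p (De p) (Dphi p) (Dk p) (Dkinv p) where
  epow := by simpa [De] using RingQuot.mkAlgHom_rel ℂ (DRel.epow (p := p))
  phipow := by simpa [Dphi] using RingQuot.mkAlgHom_rel ℂ (DRel.phipow (p := p))
  kpow := by simpa [Dk] using RingQuot.mkAlgHom_rel ℂ (DRel.kpow (p := p))
  kkinv := by simpa [Dk, Dkinv] using RingQuot.mkAlgHom_rel ℂ (DRel.kkinv (p := p))
  kinvk := by simpa [Dk, Dkinv] using RingQuot.mkAlgHom_rel ℂ (DRel.kinvk (p := p))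
  ke := by simpa only [Dk, Dkinv, De, map_mul, map_smul] using
    RingQuot.mkAlgHom_rel ℂ (DRel.ke (p := p))
  kphi := by simpa only [Dk, Dkinv, Dphi, map_mul, map_smul] using
    RingQuot.mkAlgHom_rel ℂ (DRel.kphi (p := p))
  ephi := by simpa only [Dk, Dkinv, De, Dphi, map_mul, map_smul, map_sub, map_pow] using
    RingQuot.mkAlgHom_rel ℂ (DRel.ephi (p := p))

section Lift
variable {p : ℕ} {B : Type*} [Ring B] [Algebra ℂ B]

lemma lift_exists {E F K L : B} (h : DSys p E F K L) :
    ∃ f : Dq p →ₐ[ℂ] B, f (De p) = E ∧ f (Dphi p) = F ∧ f (Dk p) = K ∧ f (Dkinv p) = L := by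
  let g : FD →ₐ[ℂ] B := FreeAlgebra.lift ℂ (fun x : DGen => match x with
    | .e => E | .phi => F | .k => K | .kinv => L)
  have ge : g fe = E := by simp [g, fe]
  have gp : g fphi = F := by simp [g, fphi]
  have gk : g fk = K := by simp [g, fk]
  have gl : g fkinv = L := by simp [g, fkinv]
  have hg : ∀ ⦃x y⦄, DRel p x y → g x = g y := by
    intro x y hxy
    cases hxy <;> simp only [map_mul, map_smul, map_sub, map_pow, map_zero, map_one, ge, gp, gk, gl]
    exacts [h.epow, h.phipow, h.kpow, h.kkinv, h.kinvk, h.ke, h.kphi, h.ephi]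
  refine ⟨RingQuot.liftAlgHom ℂ ⟨g, hg⟩, ?_, ?_, ?_, ?_⟩
  · rw [De, RingQuot.liftAlgHom_mkAlgHom_apply, ge]
  · rw [Dphi, RingQuot.liftAlgHom_mkAlgHom_apply, gp]
  · rw [Dk, RingQuot.liftAlgHom_mkAlgHom_apply, gk]
  · rw [Dkinv, RingQuot.liftAlgHom_mkAlgHom_apply, gl]

lemma D_hom_ext {B : Type*} [Semiring B] [Algebra ℂ B] {f g : Dq p →ₐ[ℂ] B} (he : f (De p) = g (De p)) (hf : f (Dphi p) = g (Dphi p))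
    (hk : f (Dk p) = g (Dk p)) (hl : f (Dkinv p) = g (Dkinv p)) : f = g := by
  apply RingQuot.ringQuot_ext'
  apply FreeAlgebra.hom_ext
  funext x
  cases x
  exacts [he, hf, hk, hl]

lemma D_induction {P : Dq p → Prop} (hc : ∀ c : ℂ, P (algebraMap ℂ _ c))
    (he : P (De p)) (hf : P (Dphi p)) (hk : P (Dk p)) (hl : P (Dkinv p))
    (hmul : ∀ a b, P a → P b → P (a * b)) (hadd : ∀ a b, P a → P b → P (a + b)) (x : Dq p) :
    P x := by
  obtain ⟨y, rfl⟩ := RingQuot.mkAlgHom_surjective ℂ (DRel p) x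
  induction y using FreeAlgebra.induction with
  | grade0 r => rw [AlgHom.commutes]; exact hc r
  | grade1 x => cases x <;> assumption
  | mul a b ha hb => rw [map_mul]; exact hmul _ _ ha hb
  | add a b ha hb => rw [map_add]; exact hadd _ _ ha hb

end Lift

section Comm
variable {p : ℕ} {B : Type*} [Ring B] [Algebra ℂ B] {E F K L : B}

lemma DSys.k_e (h : DSys p E F K L) : K * E = qq p • (E * K) := by
  rw [← smul_mul_assoc, ← h.ke, mul_assoc, h.kinvk, mul_one]

lemma DSys.k_phi (h : DSys p E F K L) : K * F = (qq p)⁻¹ • (F * K) := by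
  rw [← smul_mul_assoc, ← h.kphi, mul_assoc, h.kinvk, mul_one]

lemma DSys.l_e (h : DSys p E F K L) : L * E = (qq p)⁻¹ • (E * L) := by
  have h1 : E * L = qq p • (L * E) := by
    rw [← mul_smul_comm, ← h.ke, ← mul_assoc, ← mul_assoc, h.kinvk, one_mul]
  rw [h1, smul_smul, inv_mul_cancel₀ (qq_ne_zero p), one_smul]

lemma DSys.l_phi (h : DSys p E F K L) : L * F = qq p • (F * L) := by
  have h1 : F * L = (qq p)⁻¹ • (L * F) := by
    rw [← mul_smul_comm, ← h.kphi, ← mul_assoc, ← mul_assoc, h.kinvk, one_mul]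
  rw [h1, smul_smul, mul_inv_cancel₀ (qq_ne_zero p), one_smul]

lemma DSys.k2_e (h : DSys p E F K L) : K ^ 2 * E = qq p ^ 2 • (E * K ^ 2) := by
  rw [pow_two, mul_assoc, h.k_e, mul_smul_comm, ← mul_assoc, h.k_e, smul_mul_assoc, smul_smul,
    mul_assoc, ← pow_two]

lemma DSys.k2_phi (h : DSys p E F K L) : K ^ 2 * F = (qq p)⁻¹ ^ 2 • (F * K ^ 2) := by
  rw [pow_two, mul_assoc, h.k_phi, mul_smul_comm, ← mul_assoc, h.k_phi, smul_mul_assoc, smul_smul,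
    mul_assoc, ← pow_two, ← pow_two]

lemma DSys.l2_e (h : DSys p E F K L) : L ^ 2 * E = (qq p)⁻¹ ^ 2 • (E * L ^ 2) := by
  rw [pow_two, mul_assoc, h.l_e, mul_smul_comm, ← mul_assoc, h.l_e, smul_mul_assoc, smul_smul,
    mul_assoc, ← pow_two, ← pow_two]

lemma DSys.l2_phi (h : DSys p E F K L) : L ^ 2 * F = qq p ^ 2 • (F * L ^ 2) := by
  rw [pow_two, mul_assoc, h.l_phi, mul_smul_comm, ← mul_assoc, h.l_phi, smul_mul_assoc, smul_smul,
    mul_assoc, ← pow_two, ← pow_two]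

lemma DSys.k2_l2 (h : DSys p E F K L) : K ^ 2 * L ^ 2 = 1 := by
  rw [pow_two, pow_two, mul_assoc, ← mul_assoc K L, h.kkinv, one_mul, h.kkinv]

lemma DSys.l2_k2 (h : DSys p E F K L) : L ^ 2 * K ^ 2 = 1 := by
  rw [pow_two, pow_two, mul_assoc, ← mul_assoc L K, h.kinvk, one_mul, h.kinvk]

lemma DSys.e_l2_k2 (h : DSys p E F K L) : E * L ^ 2 * K ^ 2 = E := by rw [mul_assoc, h.l2_k2, mul_one]

lemma DSys.anti_e (h : DSys p E F K L) : E + -(E * L ^ 2) * K ^ 2 = 0 := by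
  rw [neg_mul, h.e_l2_k2, add_neg_cancel]

lemma DSys.anti_phi (h : DSys p E F K L) : L ^ 2 * -(K ^ 2 * F) + F = 0 := by
  rw [mul_neg, ← mul_assoc, h.l2_k2, one_mul, neg_add_cancel]

lemma DSys.delta (h : DSys p E F K L) (hp : 2 ≤ p) : DSys p ((1 : B) ⊗ₜ[ℂ] E + E ⊗ₜ[ℂ] (K ^ 2))
    ((L ^ 2) ⊗ₜ[ℂ] F + F ⊗ₜ[ℂ] (1 : B)) (K ⊗ₜ[ℂ] K) (L ⊗ₜ[ℂ] L) where
  epow := by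
    refine qbinom_prim (by omega) (qq_sq_prim p hp) ?_ ?_ ?_
    · simp only [Algebra.TensorProduct.tmul_mul_tmul, one_mul, mul_one, h.k2_e,
        TensorProduct.tmul_smul]
    · rw [Algebra.TensorProduct.tmul_pow, h.epow, TensorProduct.tmul_zero]
    · rw [Algebra.TensorProduct.tmul_pow, h.epow, TensorProduct.zero_tmul]
  phipow := by
    rw [add_comm]
    refine qbinom_prim (by omega) (qq_sq_prim p hp) ?_ ?_ ?_
    · simp only [Algebra.TensorProduct.tmul_mul_tmul, one_mul, mul_one, h.l2_phi,
        TensorProduct.smul_tmul']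
    · rw [Algebra.TensorProduct.tmul_pow, h.phipow, TensorProduct.zero_tmul]
    · rw [Algebra.TensorProduct.tmul_pow, h.phipow, TensorProduct.tmul_zero]
  kpow := by
    rw [Algebra.TensorProduct.tmul_pow, h.kpow, Algebra.TensorProduct.one_def]
  kkinv := by
    rw [Algebra.TensorProduct.tmul_mul_tmul, h.kkinv, Algebra.TensorProduct.one_def]
  kinvk := by
    rw [Algebra.TensorProduct.tmul_mul_tmul, h.kinvk, Algebra.TensorProduct.one_def]
  ke := by
    simp only [mul_add, add_mul, Algebra.TensorProduct.tmul_mul_tmul, mul_one, h.kkinv, h.ke,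
      smul_add, TensorProduct.tmul_smul, TensorProduct.smul_tmul']
    rw [← pow_succ', pow_succ, mul_assoc, h.kkinv, mul_one]
  kphi := by
    have : K * L ^ 2 * L = L ^ 2 := by rw [pow_two, ← mul_assoc, h.kkinv, one_mul]
    simp only [mul_add, add_mul, Algebra.TensorProduct.tmul_mul_tmul, mul_one, h.kkinv, h.kphi,
      smul_add, TensorProduct.tmul_smul, TensorProduct.smul_tmul', this]
  ephi := by
    have h1 : (L ^ 2 * E) ⊗ₜ[ℂ] (F * K ^ 2) = (E * L ^ 2) ⊗ₜ[ℂ] (K ^ 2 * F) := by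
      rw [h.l2_e, h.k2_phi, TensorProduct.tmul_smul, TensorProduct.smul_tmul']
    have h2 : E * F = F * E + (qq p - (qq p)⁻¹)⁻¹ • (K ^ 2 - L ^ 2) := by
      rw [← h.ephi]; abel
    simp only [mul_add, add_mul, Algebra.TensorProduct.tmul_mul_tmul, one_mul, mul_one, h1,
      Algebra.TensorProduct.tmul_pow]
    rw [h2]
    simp only [TensorProduct.tmul_add, TensorProduct.add_tmul, TensorProduct.tmul_smul,
      ← TensorProduct.smul_tmul', TensorProduct.tmul_sub, TensorProduct.sub_tmul, smul_sub]
    abel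

lemma DSys.antipode (h : DSys p E F K L) : DSys p (MulOpposite.op (-(E * L ^ 2))) (MulOpposite.op (-(K ^ 2 * F)))
    (MulOpposite.op L) (MulOpposite.op K) where
  epow := by
    rw [← MulOpposite.op_pow, neg_pow, qcomm_mul_pow_zero h.l2_e p h.epow, mul_zero,
      MulOpposite.op_zero]
  phipow := by
    rw [← MulOpposite.op_pow, neg_pow, h.k2_phi, smul_pow,
      qcomm_mul_pow_zero h.k2_phi p h.phipow, smul_zero, mul_zero, MulOpposite.op_zero]
  kpow := by
    have hc : L ^ (4 * p) * K ^ (4 * p) = 1 := by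
      rw [← (show Commute L K from h.kinvk.trans h.kkinv.symm).mul_pow, h.kinvk, one_pow]
    rw [h.kpow, mul_one] at hc
    rw [← MulOpposite.op_pow, hc, MulOpposite.op_one]
  kkinv := by rw [← MulOpposite.op_mul, h.kkinv, MulOpposite.op_one]
  kinvk := by rw [← MulOpposite.op_mul, h.kinvk, MulOpposite.op_one]
  ke := by
    rw [← MulOpposite.op_mul, ← MulOpposite.op_mul, ← MulOpposite.op_smul]
    congr 1
    rw [neg_mul, mul_neg, smul_neg, mul_assoc E, ← pow_succ, pow_succ', ← mul_assoc, ← mul_assoc,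
      h.ke, smul_mul_assoc]
  kphi := by
    rw [← MulOpposite.op_mul, ← MulOpposite.op_mul, ← MulOpposite.op_smul]
    congr 1
    rw [neg_mul, mul_neg, smul_neg, ← mul_assoc, ← mul_assoc, ← pow_succ', pow_succ, mul_assoc,
      mul_assoc, ← mul_assoc K, h.kphi, mul_smul_comm]
  ephi := by
    have h1 : K ^ 2 * F * (E * L ^ 2) = F * E := by
      rw [h.k2_phi, smul_mul_assoc, mul_assoc, ← mul_assoc (K ^ 2) E, h.k2_e, smul_mul_assoc,
        mul_smul_comm, smul_smul, ← mul_pow, inv_mul_cancel₀ (qq_ne_zero p), one_pow, one_smul,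
        mul_assoc, h.k2_l2, mul_one]
    have h2 : E * L ^ 2 * (K ^ 2 * F) = E * F := by
      rw [← mul_assoc, h.e_l2_k2]
    rw [← MulOpposite.op_mul, ← MulOpposite.op_mul, ← MulOpposite.op_pow, ← MulOpposite.op_pow,
      ← MulOpposite.op_sub, ← MulOpposite.op_sub, ← MulOpposite.op_smul]
    congr 1
    rw [neg_mul_neg, neg_mul_neg, h1, h2, ← neg_sub, h.ephi, ← smul_neg, neg_sub]

end Comm

lemma dsys_counit (p : ℕ) (hp : 2 ≤ p) : DSys p (0 : ℂ) 0 1 1 where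
  epow := zero_pow (by omega)
  phipow := zero_pow (by omega)
  kpow := by simp
  kkinv := by simp
  kinvk := by simp
  ke := by simp
  kphi := by simp
  ephi := by simp

section Anti
variable {A : Type*} [Ring A] [Algebra ℂ A]

/-- the algebra homomorphism to the opposite algebra attached to an anti-homomorphism -/
def antiHom (S : A →ₗ[ℂ] A) (h1 : S 1 = 1) (hm : ∀ x y, S (x * y) = S y * S x) :
    A →ₐ[ℂ] Aᵐᵒᵖ :=
  AlgHom.ofLinearMap ((MulOpposite.opLinearEquiv ℂ).toLinearMap ∘ₗ S)
    (by simp [h1]) (by intro x y; simp [hm])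

variable (S : A →ₗ[ℂ] A)

lemma left_mul (hm : ∀ x y, S (x * y) = S y * S x) {t : A ⊗[ℂ] A} {c : ℂ}
    (ht : LinearMap.mul' ℂ A (TensorProduct.map S LinearMap.id t) = c • 1) (s : A ⊗[ℂ] A) :
    LinearMap.mul' ℂ A (TensorProduct.map S LinearMap.id (t * s)) =
      c • LinearMap.mul' ℂ A (TensorProduct.map S LinearMap.id s) := by
  have key : ∀ (b b' : A) (t : A ⊗[ℂ] A),
      LinearMap.mul' ℂ A (TensorProduct.map S LinearMap.id (t * b ⊗ₜ[ℂ] b')) =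
      S b * LinearMap.mul' ℂ A (TensorProduct.map S LinearMap.id t) * b' := by
    intro b b' t
    induction t using TensorProduct.induction_on with
    | zero => simp
    | tmul a a' => simp [hm, mul_assoc]
    | add x y hx hy => rw [add_mul, map_add, map_add, hx, hy, map_add, map_add, mul_add, add_mul]
  induction s using TensorProduct.induction_on with
  | zero => simp
  | tmul b b' => rw [key, ht]; simp
  | add x y hx hy => rw [mul_add, map_add, map_add, hx, hy, map_add, map_add, smul_add]

lemma right_mul (hm : ∀ x y, S (x * y) = S y * S x) {s : A ⊗[ℂ] A} {c : ℂ}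
    (hs : LinearMap.mul' ℂ A (TensorProduct.map LinearMap.id S s) = c • 1) (t : A ⊗[ℂ] A) :
    LinearMap.mul' ℂ A (TensorProduct.map LinearMap.id S (t * s)) =
      c • LinearMap.mul' ℂ A (TensorProduct.map LinearMap.id S t) := by
  have key : ∀ (b b' : A) (t : A ⊗[ℂ] A),
      LinearMap.mul' ℂ A (TensorProduct.map LinearMap.id S (b ⊗ₜ[ℂ] b' * t)) =
      b * LinearMap.mul' ℂ A (TensorProduct.map LinearMap.id S t) * S b' := by
    intro b b' t
    induction t using TensorProduct.induction_on with
    | zero => simp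
    | tmul a a' => simp [hm, mul_assoc]
    | add x y hx hy => rw [mul_add, map_add, map_add, hx, hy, map_add, map_add, mul_add, add_mul]
  induction t using TensorProduct.induction_on with
  | zero => simp
  | tmul b b' => rw [key, hs]; simp
  | add x y hx hy => rw [add_mul, map_add, map_add, hx, hy, map_add, map_add, smul_add]

end Anti

section Hopf
variable {p : ℕ} {Δ : Dq p →ₐ[ℂ] Dq p ⊗[ℂ] Dq p} {ε : Dq p →ₐ[ℂ] ℂ} {S : Dq p →ₗ[ℂ] Dq p}

lemma coassoc_D (hΔ : IsDeltaD p Δ) : Coassoc Δ := by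
  obtain ⟨he, hf, hk, hl⟩ := hΔ
  have key : ((Algebra.TensorProduct.assoc ℂ ℂ ℂ (Dq p) (Dq p) (Dq p)).toAlgHom.comp
      (Algebra.TensorProduct.map Δ (AlgHom.id ℂ (Dq p)))).comp Δ =
      (Algebra.TensorProduct.map (AlgHom.id ℂ (Dq p)) Δ).comp Δ := by
    apply D_hom_ext
    · simp [he, hk, TensorProduct.add_tmul, TensorProduct.tmul_add,
        Algebra.TensorProduct.one_def, add_assoc]
    · simp [hf, hl, TensorProduct.add_tmul, TensorProduct.tmul_add,
        Algebra.TensorProduct.one_def, add_assoc]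
    · simp [hk]
    · simp [hl]
  intro x
  exact AlgHom.congr_fun key x

lemma counit_D (hΔ : IsDeltaD p Δ) (hε : IsCounitD p ε) : CounitAxiom Δ ε := by
  obtain ⟨he, hf, hk, hl⟩ := hΔ
  obtain ⟨ee, ef, ek, el⟩ := hε
  have key1 : ((Algebra.TensorProduct.lid ℂ (Dq p)).toAlgHom.comp
      (Algebra.TensorProduct.map ε (AlgHom.id ℂ (Dq p)))).comp Δ = AlgHom.id ℂ (Dq p) := by
    apply D_hom_ext <;> simp [he, hf, hk, hl, ee, ef, ek, el]
  have key2 : ((Algebra.TensorProduct.rid ℂ ℂ (Dq p)).toAlgHom.comp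
      (Algebra.TensorProduct.map (AlgHom.id ℂ (Dq p)) ε)).comp Δ = AlgHom.id ℂ (Dq p) := by
    apply D_hom_ext <;> simp [he, hf, hk, hl, ee, ef, ek, el]
  exact ⟨fun x => AlgHom.congr_fun key1 x, fun x => AlgHom.congr_fun key2 x⟩

lemma antipode_D (hΔ : IsDeltaD p Δ) (hε : IsCounitD p ε) (hS : IsAntipodeD p S) :
    AntipodeAxiom Δ ε S := by
  obtain ⟨he, hf, hk, hl⟩ := hΔ
  obtain ⟨ee, ef, ek, el⟩ := hε
  obtain ⟨s1, sm, se, sf, sk, sl⟩ := hS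
  have h := dsys_D p
  have sl2 : S (Dkinv p ^ 2) = Dk p ^ 2 := by rw [pow_two, sm, sl, pow_two]
  have sk2 : S (Dk p ^ 2) = Dkinv p ^ 2 := by rw [pow_two, sm, sk, pow_two]
  constructor
  · intro x
    induction x using D_induction with
    | hc c =>
      rw [AlgHom.commutes, AlgHom.commutes, Algebra.algebraMap_eq_smul_one, map_smul,
        map_smul, Algebra.TensorProduct.one_def]
      simp [s1]
    | he => rw [he, ee]; simp [s1, se]; exact h.anti_e
    | hf => rw [hf, ef]; simp [sf, sl2]
    | hk => rw [hk, ek]; simp [sk, h.kinvk]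
    | hl => rw [hl, el]; simp [sl, h.kkinv]
    | hmul a b ha hb => rw [map_mul, left_mul S sm ha, hb, map_mul, smul_smul]
    | hadd a b ha hb => rw [map_add, map_add, map_add, ha, hb, map_add, add_smul]
  · intro x
    induction x using D_induction with
    | hc c =>
      rw [AlgHom.commutes, AlgHom.commutes, Algebra.algebraMap_eq_smul_one, map_smul,
        map_smul, Algebra.TensorProduct.one_def]
      simp [s1]
    | he => rw [he, ee]; simp [se, sk2]
    | hf => rw [hf, ef]; simp [s1, sf]; exact h.anti_phi
    | hk => rw [hk, ek]; simp [sk, h.kkinv]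
    | hl => rw [hl, el]; simp [sl, h.kinvk]
    | hmul a b ha hb => rw [map_mul, right_mul S sm hb, ha, map_mul, smul_smul, mul_comm]
    | hadd a b ha hb => rw [map_add, map_add, map_add, ha, hb, map_add, add_smul]

end Hopf

end LogHennings

open LogHennings in
/-- Existence and uniqueness of the Hopf algebra structure maps of `D`, and the
fact that they satisfy the Hopf algebra axioms. -/
theorem hopf_structure_D (p : ℕ) (hp : 2 ≤ p) :
    (∃! Δ : Dq p →ₐ[ℂ] Dq p ⊗[ℂ] Dq p, IsDeltaD p Δ) ∧
    (∃! ε : Dq p →ₐ[ℂ] ℂ, IsCounitD p ε) ∧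
    (∃! S : Dq p →ₗ[ℂ] Dq p, IsAntipodeD p S) ∧
    (∀ (Δ : Dq p →ₐ[ℂ] Dq p ⊗[ℂ] Dq p) (ε : Dq p →ₐ[ℂ] ℂ)
        (S : Dq p →ₗ[ℂ] Dq p),
      IsDeltaD p Δ → IsCounitD p ε → IsAntipodeD p S →
      Coassoc Δ ∧ CounitAxiom Δ ε ∧ AntipodeAxiom Δ ε S) := by
  refine ⟨?_, ?_, ?_, fun Δ ε S hΔ hε hS => ⟨coassoc_D hΔ, counit_D hΔ hε, antipode_D hΔ hε hS⟩⟩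
  · obtain ⟨f, hf⟩ := lift_exists ((dsys_D p).delta hp)
    refine ⟨f, hf, fun g hg => ?_⟩
    obtain ⟨a, b, c, d⟩ := hf
    obtain ⟨a', b', c', d'⟩ := hg
    exact D_hom_ext (a'.trans a.symm) (b'.trans b.symm) (c'.trans c.symm) (d'.trans d.symm)
  · obtain ⟨f, hf⟩ := lift_exists (dsys_counit p hp)
    refine ⟨f, hf, fun g hg => ?_⟩
    obtain ⟨a, b, c, d⟩ := hf
    obtain ⟨a', b', c', d'⟩ := hg
    exact D_hom_ext (a'.trans a.symm) (b'.trans b.symm) (c'.trans c.symm) (d'.trans d.symm)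
  · obtain ⟨f, a, b, c, d⟩ := lift_exists (dsys_D p).antipode
    refine ⟨(MulOpposite.opLinearEquiv ℂ).symm.toLinearMap ∘ₗ f.toLinearMap,
      ⟨?_, ?_, ?_, ?_, ?_, ?_⟩, fun g hg => ?_⟩
    · simp
    · intro x y; simp
    · simp [a]
    · simp [b]
    · simp [c]
    · simp [d]
    · obtain ⟨g1, gm, a', b', c', d'⟩ := hg
      have key : antiHom g g1 gm = f := by
        apply D_hom_ext
        · rw [a, ← a']; rfl
        · rw [b, ← b']; rfl
        · rw [c, ← c']; rfl
        · rw [d, ← d']; rfl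
      rw [← key]
      rfl
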